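/- Fix an integer ℓ ≥ 1 and constants η₀, η∞, θ₀, θ∞, g ∈ ℂ; set α = −4η∞θ∞, β = 4η₀(θ₀+1), γ = 4η∞², δ = −4η₀². Let I ⊆ (0,∞) be an open interval and let q_j, p_j : I → ℂ (j = 1,…,ℓ) be differentiable with sinh((q_j−q_k)/2) ≠ 0 on I for each j ≠ k. Suppose they satisfy the canonical equations t q_j' = (∂𝓗/∂p_j) and t p_j' = −(∂𝓗/∂q_j) for the Hamiltonian 𝓗(q,p,t) = Σ_{j=1}^{ℓ} [ p_j²/2 − (α/4)e^{q_j} + (βt/4)e^{−q_j} − (γ/8)e^{2q_j} + (δt²/8)e^{−2q_j} ] + g² Σ_{j≠k} 1/sinh²((q_j−q_k)/2). Define λ_j = exp(q_j) and μ_j = p_j/(2λ_j) + (1/2)( η∞ + θ₀/λ_j − η₀ t/λ_j² ). Then λ_j ≠ λ_k on I for j ≠ k, and the λ_j, μ_j satisfy the canonical equations λ_j' = (∂H/∂μ_j) and μ_j' = −(∂H/∂λ_j) for the multi-component P_III Hamiltonian H(λ,μ,t) = Σ_{j=1}^{ℓ} (λ_j²/t)·[ μ_j² − ( η∞ + θ₀/λ_j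 − η₀ t/λ_j² )·μ_j + η∞(θ₀+θ∞)/(2λ_j) ] + (2g²/t) Σ_{j≠k} λ_jλ_k/(λ_j−λ_k)². -/

import Mathlib

open Complex

/-- Varying one coordinate of a separable sum differentiates only the corresponding summand. -/
theorem hasDerivAt_sum_update {ι : Type*} [Fintype ι] [DecidableEq ι] (F : ι → ℂ → ℂ)
    (v : ι → ℂ) (j : ι) {d : ℂ} (h : HasDerivAt (F j) d (v j)) :
    HasDerivAt (fun x => ∑ i, F i (Function.update v j x i)) d (v j) := by
  have key : ∀ i ∈ (Finset.univ : Finset ι),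
      HasDerivAt (fun x => F i (Function.update v j x i)) (if i = j then d else 0) (v j) := by
    intro i _
    by_cases hij : i = j
    · subst hij
      simpa using h
    · simpa [hij] using hasDerivAt_const (v j) (F i (v i))
  simpa using HasDerivAt.fun_sum key

/-- The rational form of the pair potential. -/
noncomputable def pairPotential {ι : Type*} [Fintype ι] [DecidableEq ι] (L : ι → ℂ) : ℂ :=
  ∑ j, ∑ k, (if j ≠ k then L j * L k / (L j - L k) ^ 2 else 0)

theorem differentiableAt_pairPotential_update {ι : Type*} [Fintype ι] [DecidableEq ι]
    {L : ι → ℂ} (hL : Function.Injective L) (j : ι) :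
    DifferentiableAt ℂ (fun x => pairPotential (Function.update L j x)) (L j) := by
  unfold pairPotential
  refine DifferentiableAt.fun_sum fun a _ => DifferentiableAt.fun_sum fun b _ => ?_
  have hc : ∀ i, DifferentiableAt ℂ (fun x => Function.update L j x i) (L j) := by
    intro i
    by_cases hij : i = j
    · subst hij
      simp
    · simp [hij]
  by_cases hab : a = b
  · simp [hab]
  · simp only [ne_eq, hab, not_false_eq_true, if_true]
    refine ((hc a).mul (hc b)).div (((hc a).sub (hc b)).pow 2) ?_
    simpa [Function.update_eq_self, sub_eq_zero] using hL.ne hab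

theorem one_div_sinh_half_sub_sq (a b : ℂ) :
    1 / sinh ((a - b) / 2) ^ 2 = 4 * (exp a * exp b / (exp a - exp b) ^ 2) := by
  have ha : exp a = exp (a / 2) ^ 2 := by rw [← exp_nat_mul]; congr 1; push_cast; ring
  have hb : exp b = exp (b / 2) ^ 2 := by rw [← exp_nat_mul]; congr 1; push_cast; ring
  have hs : sinh ((a - b) / 2) =
      (exp a - exp b) / (2 * (exp (a / 2) * exp (b / 2))) := by
    rw [sinh, ha, hb, show -((a - b) / 2) = b / 2 - a / 2 by ring,
      show (a - b) / 2 = a / 2 - b / 2 by ring, exp_sub, exp_sub]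
    field_simp
  rw [hs, div_pow, one_div_div, ha, hb]
  ring

theorem sum_one_div_sinh_half_sub_sq {ι : Type*} [Fintype ι] [DecidableEq ι] (Q : ι → ℂ) :
    (∑ j, ∑ k, (if j ≠ k then 1 / sinh ((Q j - Q k) / 2) ^ 2 else 0)) =
      4 * pairPotential (fun i => exp (Q i)) := by
  simp only [pairPotential, Finset.mul_sum, one_div_sinh_half_sub_sq, mul_ite, mul_zero]

/-- Distinctness of exponentials from nonvanishing of the hyperbolic sine of half the
difference. -/
theorem exp_ne_exp_of_sinh_half_sub_ne_zero {a b : ℂ} (h : sinh ((a - b) / 2) ≠ 0) :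
    exp a ≠ exp b := by
  intro hab
  have h' := one_div_sinh_half_sub_sq a b
  simp [hab, h] at h'

/-- The canonical transformation from the rank-ℓ non-autonomous exponential-hyperbolic
model to the multi-component third Painlevé equation. -/
theorem multi_component_PIII
    (ℓ : ℕ) (hℓ : 1 ≤ ℓ) (η₀ ηinf θ₀ θinf g α β γ δ : ℂ)
    (hα : α = -4 * ηinf * θinf) (hβ : β = 4 * η₀ * (θ₀ + 1))
    (hγ : γ = 4 * ηinf ^ 2) (hδ : δ = -4 * η₀ ^ 2)
    (I : Set ℝ) (hI : IsOpen I) (hIpos : I ⊆ Set.Ioi (0 : ℝ))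
    (q p q' p' : Fin ℓ → ℝ → ℂ)
    (hq : ∀ j, ∀ t ∈ I, HasDerivAt (q j) (q' j t) t)
    (hp : ∀ j, ∀ t ∈ I, HasDerivAt (p j) (p' j t) t)
    (hd : ∀ j k, j ≠ k → ∀ t ∈ I, Complex.sinh ((q j t - q k t) / 2) ≠ 0)
    (𝓗 : (Fin ℓ → ℂ) → (Fin ℓ → ℂ) → ℝ → ℂ)
    (h𝓗 : ∀ Q P t, 𝓗 Q P t =
        (∑ j, (P j ^ 2 / 2 - α / 4 * Complex.exp (Q j)
            + β * (t : ℂ) / 4 * Complex.exp (-Q j)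
            - γ / 8 * Complex.exp (2 * Q j)
            + δ * (t : ℂ) ^ 2 / 8 * Complex.exp (-(2 * Q j))))
        + g ^ 2 * ∑ j, ∑ k,
            (if j ≠ k then 1 / Complex.sinh ((Q j - Q k) / 2) ^ 2 else 0))
    (hham1 : ∀ j, ∀ t ∈ I, (t : ℂ) * q' j t =
        deriv (fun x => 𝓗 (fun i => q i t) (Function.update (fun i => p i t) j x) t)
          (p j t))
    (hham2 : ∀ j, ∀ t ∈ I, (t : ℂ) * p' j t =
        -deriv (fun x => 𝓗 (Function.update (fun i => q i t) j x) (fun i => p i t) t)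
          (q j t))
    (lam mu : Fin ℓ → ℝ → ℂ)
    (hlam : ∀ j t, lam j t = Complex.exp (q j t))
    (hmu : ∀ j t, mu j t = p j t / (2 * lam j t)
        + (ηinf + θ₀ / lam j t - η₀ * (t : ℂ) / lam j t ^ 2) / 2)
    (H : (Fin ℓ → ℂ) → (Fin ℓ → ℂ) → ℝ → ℂ)
    (hH : ∀ L M t, H L M t =
        (∑ j, L j ^ 2 / (t : ℂ) *
            (M j ^ 2 - (ηinf + θ₀ / L j - η₀ * (t : ℂ) / L j ^ 2) * M j
              + ηinf * (θ₀ + θinf) / (2 * L j)))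
        + 2 * g ^ 2 / (t : ℂ) * ∑ j, ∑ k,
            (if j ≠ k then L j * L k / (L j - L k) ^ 2 else 0)) :
    (∀ j k, j ≠ k → ∀ t ∈ I, lam j t ≠ lam k t) ∧
    (∀ j, ∀ t ∈ I,
      HasDerivAt (lam j)
        (deriv (fun x => H (fun i => lam i t) (Function.update (fun i => mu i t) j x) t)
          (mu j t)) t
      ∧ HasDerivAt (mu j)
        (-deriv (fun x => H (Function.update (fun i => lam i t) j x) (fun i => mu i t) t)
          (lam j t)) t) := by
  have hne : ∀ j k, j ≠ k → ∀ t ∈ I, lam j t ≠ lam k t := fun j k hjk t ht => by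
    rw [hlam, hlam]
    exact exp_ne_exp_of_sinh_half_sub_ne_zero (hd j k hjk t ht)
  refine ⟨hne, fun j t ht => ?_⟩
  have ht0 : (t : ℂ) ≠ 0 := ofReal_ne_zero.mpr (ne_of_gt (hIpos ht))
  have hl0 : lam j t ≠ 0 := hlam j t ▸ exp_ne_zero _
  obtain ⟨D, hD⟩ : ∃ D, HasDerivAt
      (fun x => pairPotential (Function.update (fun i => lam i t) j x)) D (lam j t) :=
    ⟨_, (differentiableAt_pairPotential_update
      (fun a b hab => by_contra fun h => hne a b h t ht hab) j).hasDerivAt⟩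
  have hA : HasDerivAt
      (fun x => 𝓗 (fun i => q i t) (Function.update (fun i => p i t) j x) t)
      (p j t) (p j t) := by
    simp only [h𝓗]
    refine HasDerivAt.add_const _ (hasDerivAt_sum_update
      (fun i y => y ^ 2 / 2 - α / 4 * exp (q i t) + β * (t : ℂ) / 4 * exp (-q i t)
        - γ / 8 * exp (2 * q i t) + δ * (t : ℂ) ^ 2 / 8 * exp (-(2 * q i t)))
      (fun i => p i t) j ?_)
    convert! ((((((hasDerivAt_id (p j t)).pow 2).div_const 2).sub_const _).add_const
      _).sub_const _).add_const _ using 1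
    simp
  have hB : HasDerivAt
      (fun x => 𝓗 (Function.update (fun i => q i t) j x) (fun i => p i t) t)
      (-(α / 4) * lam j t - β * t / 4 / lam j t - γ / 4 * lam j t ^ 2
        - δ * t ^ 2 / 4 / lam j t ^ 2 + g ^ 2 * (4 * (D * lam j t))) (q j t) := by
    simp only [h𝓗, sum_one_div_sinh_half_sub_sq]
    refine HasDerivAt.add (hasDerivAt_sum_update
      (fun i y => p i t ^ 2 / 2 - α / 4 * exp y + β * (t : ℂ) / 4 * exp (-y)
        - γ / 8 * exp (2 * y) + δ * (t : ℂ) ^ 2 / 8 * exp (-(2 * y)))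
      (fun i => q i t) j ?_) (HasDerivAt.const_mul _ (HasDerivAt.const_mul _ ?_))
    · have e1 := hasDerivAt_exp (q j t)
      have e2 := (hasDerivAt_id (q j t)).neg.cexp
      have e3 := ((hasDerivAt_id (q j t)).const_mul 2).cexp
      have e4 := ((hasDerivAt_id (q j t)).const_mul 2).neg.cexp
      convert! ((((e1.const_mul (α / 4)).const_sub (p j t ^ 2 / 2)).add
        (e2.const_mul (β * (t : ℂ) / 4))).sub (e3.const_mul (γ / 8))).add
        (e4.const_mul (δ * (t : ℂ) ^ 2 / 8)) using 1
      have h2 : exp (2 * q j t) = exp (q j t) ^ 2 := by rw [← exp_nat_mul]; norm_num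
      simp only [hlam, id, Pi.neg_apply, exp_neg, h2]
      field_simp
      ring
    · have hupd : ∀ x, (fun i => exp (Function.update (fun i => q i t) j x i)) =
          Function.update (fun i => lam i t) j (exp x) := by
        intro x
        ext i
        by_cases hij : i = j
        · subst hij
          simp
        · simp [hij, hlam]
      simp only [hupd]
      rw [hlam] at hD ⊢
      exact hD.comp (q j t) (hasDerivAt_exp (q j t))
  have hq1 := hham1 j t ht
  have hp1 := hham2 j t ht
  rw [hA.deriv] at hq1
  rw [hB.deriv] at hp1
  have hmj := hmu j t
  have hC : HasDerivAt
      (fun x => H (fun i => lam i t) (Function.update (fun i => mu i t) j x) t)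
      (lam j t ^ 2 / t * (2 * mu j t
        - (ηinf + θ₀ / lam j t - η₀ * t / lam j t ^ 2))) (mu j t) := by
    simp only [hH]
    refine HasDerivAt.add_const _ (hasDerivAt_sum_update
      (fun i y => lam i t ^ 2 / (t : ℂ) *
        (y ^ 2 - (ηinf + θ₀ / lam i t - η₀ * (t : ℂ) / lam i t ^ 2) * y
          + ηinf * (θ₀ + θinf) / (2 * lam i t)))
      (fun i => mu i t) j ?_)
    convert! ((((hasDerivAt_id (mu j t)).pow 2).sub ((hasDerivAt_id (mu j t)).const_mul
      (ηinf + θ₀ / lam j t - η₀ * (t : ℂ) / lam j t ^ 2))).add_const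
      _).const_mul (lam j t ^ 2 / (t : ℂ)) using 1
    simp
  have hE : HasDerivAt
      (fun x => H (Function.update (fun i => lam i t) j x) (fun i => mu i t) t)
      ((2 * lam j t * mu j t ^ 2 - (2 * ηinf * lam j t + θ₀) * mu j t
        + ηinf * (θ₀ + θinf) / 2) / t + 2 * g ^ 2 / t * D) (lam j t) := by
    simp only [hH]
    refine HasDerivAt.add (hasDerivAt_sum_update
      (fun i y => y ^ 2 / (t : ℂ) *
        (mu i t ^ 2 - (ηinf + θ₀ / y - η₀ * (t : ℂ) / y ^ 2) * mu i t
          + ηinf * (θ₀ + θinf) / (2 * y)))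
      (fun i => lam i t) j ?_) (HasDerivAt.const_mul _ hD)
    have i1 := hasDerivAt_id (lam j t)
    have i2 := (i1.pow 2).div_const (t : ℂ)
    have i3 := (((hasDerivAt_const (lam j t) θ₀).div i1 hl0).const_add ηinf).sub
      ((hasDerivAt_const (lam j t) (η₀ * (t : ℂ))).div (i1.pow 2) (pow_ne_zero 2 hl0))
    have i4 := (hasDerivAt_const (lam j t) (ηinf * (θ₀ + θinf))).div (i1.const_mul 2)
      (mul_ne_zero two_ne_zero hl0)
    convert! i2.mul (((i3.mul_const (mu j t)).const_sub (mu j t ^ 2)).add i4) using 1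
    simp
    field_simp
    ring
  have hq2 : q' j t = p j t / t := by rw [← hq1]; field_simp
  have hlam' : HasDerivAt (lam j) (lam j t * (p j t / t)) t := by
    rw [show lam j = fun s => exp (q j s) from funext (hlam j), ← hq2]
    exact (hq j t ht).cexp
  refine ⟨?_, ?_⟩
  · rw [hC.deriv]
    convert hlam' using 1
    rw [hmj]
    field_simp
    ring
  · rw [hE.deriv, show mu j = _ from funext (hmu j)]
    have ht' : HasDerivAt (fun s : ℝ => (s : ℂ)) 1 t := ofRealCLM.hasDerivAt
    have hp2 := eq_div_of_mul_eq ht0 ((mul_comm _ _).trans hp1)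
    convert! ((hp j t ht).div (hlam'.const_mul 2) (mul_ne_zero two_ne_zero hl0)).add
      (((((hasDerivAt_const t θ₀).div hlam' hl0).const_add ηinf).sub
        ((ht'.const_mul η₀).div (hlam'.pow 2) (pow_ne_zero 2 hl0))).div_const 2) using 1
    rw [hp2, hα, hβ, hγ, hδ]
    simp
    field_simp
    ring
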